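/- Let x, y ∈ (0,1] and let f : [0,1]^2 → ℝ be twice continuously differentiable. Then the limit as n → ∞ of n · ( B_{n,2}^{[2]}f(x,y) - B_n^{[2]}f(x,y) ) equals -((1-x)/2) · ∂f/∂x (x,y) - ((1-y)/2) · ∂f/∂y (x,y). -/

import Mathlib

open Filter Finset

/-- Bernstein basis polynomial `p_{n,k}(x) = C(n,k) x^k (1-x)^{n-k}`. -/
noncomputable def bern (n k : ℕ) (x : ℝ) : ℝ := (n.choose k : ℝ) * x ^ k * (1 - x) ^ (n - k)

/-- The AKR node `t_{n,k} = √(k(k-1)/(n(n-1)))`. -/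
noncomputable def akrNode (n k : ℕ) : ℝ := Real.sqrt ((k * (k - 1)) / (n * (n - 1)))

/-- The unit square `[0,1]²`. -/
def unitSquare : Set (ℝ × ℝ) := Set.Icc 0 1 ×ˢ Set.Icc 0 1

/-- Partial derivative in the first variable, taken within `[0,1]`. -/
noncomputable def pderivX (f : ℝ × ℝ → ℝ) (p : ℝ × ℝ) : ℝ :=
  derivWithin (fun s => f (s, p.2)) (Set.Icc 0 1) p.1

/-- Partial derivative in the second variable, taken within `[0,1]`. -/
noncomputable def pderivY (f : ℝ × ℝ → ℝ) (p : ℝ × ℝ) : ℝ :=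
  derivWithin (fun t => f (p.1, t)) (Set.Icc 0 1) p.2

/-- The bivariate tensor-product Bernstein operator
`B_n^{[2]} f(x,y) = Σ_{k=0}^n Σ_{l=0}^n f(k/n, l/n) p_{n,k}(x) p_{n,l}(y)`. -/
noncomputable def bernstein2Op (n : ℕ) (f : ℝ × ℝ → ℝ) (x y : ℝ) : ℝ :=
  ∑ k ∈ Finset.range (n + 1), ∑ l ∈ Finset.range (n + 1),
    f ((k : ℝ) / n, (l : ℝ) / n) * bern n k x * bern n l y

/-- The bivariate Aldaz–Kounchev–Render operator with `j = 2`: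
`B_{n,2}^{[2]} f(x,y) = Σ_{k=0}^n Σ_{l=0}^n f(t_{n,k}, t_{n,l}) p_{n,k}(x) p_{n,l}(y)`. -/
noncomputable def akr2Op (n : ℕ) (f : ℝ × ℝ → ℝ) (x y : ℝ) : ℝ :=
  ∑ k ∈ Finset.range (n + 1), ∑ l ∈ Finset.range (n + 1),
    f (akrNode n k, akrNode n l) * bern n k x * bern n l y

open Asymptotics
open scoped Topology

theorem bern_eq_eval (n k : ℕ) (x : ℝ) : bern n k x = (bernsteinPolynomial ℝ n k).eval x := by
  simp [bern, bernsteinPolynomial]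

theorem bern_nonneg {x : ℝ} (hx : x ∈ Set.Icc (0 : ℝ) 1) (n k : ℕ) : 0 ≤ bern n k x := by
  have h0 := hx.1
  have h1 : 0 ≤ 1 - x := sub_nonneg.2 hx.2
  unfold bern
  positivity

theorem sum_bern (n : ℕ) (x : ℝ) : ∑ k ∈ range (n + 1), bern n k x = 1 := by
  simp only [bern_eq_eval, ← Polynomial.eval_finsetSum, bernsteinPolynomial.sum,
    Polynomial.eval_one]

theorem sum_sq_mul_bern {n : ℕ} (hn : n ≠ 0) (x : ℝ) :
    ∑ k ∈ range (n + 1), ((k : ℝ) / n - x) ^ 2 * bern n k x = x * (1 - x) / n := by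
  have h := congrArg (Polynomial.eval x) (bernsteinPolynomial.variance ℝ n)
  simp only [Polynomial.eval_finsetSum, Polynomial.eval_mul, Polynomial.eval_pow,
    Polynomial.eval_sub, Polynomial.eval_X, Polynomial.eval_natCast,
    Polynomial.eval_one, nsmul_eq_mul, ← bern_eq_eval] at h
  have hn' : (n : ℝ) ≠ 0 := Nat.cast_ne_zero.2 hn
  rw [eq_div_iff hn', ← mul_left_inj' hn', Finset.sum_mul, Finset.sum_mul,
    show x * (1 - x) * n = n * x * (1 - x) by ring, ← h]
  refine Finset.sum_congr rfl fun k _ => ?_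
  field_simp
  ring

/-- The filter of triples `(n, k, l)` with `k, l ≤ n`, `n → ∞` and `(k/n, l/n) → (x, y)`. -/
noncomputable def gridFilter (x y : ℝ) : Filter (ℕ × ℕ × ℕ) :=
  comap (fun i => (i.1, ((i.2.1 : ℝ) / i.1, (i.2.2 : ℝ) / i.1))) (atTop ×ˢ 𝓝 (x, y)) ⊓
    𝓟 {i | i.2.1 ≤ i.1 ∧ i.2.2 ≤ i.1}

/-- Averages against the tensor-product Bernstein weights concentrate at `(x, y)`. -/
theorem tendsto_sum_bern_of_tendsto_gridFilter {x y : ℝ} (hx : x ∈ Set.Icc (0 : ℝ) 1)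
    (hy : y ∈ Set.Icc (0 : ℝ) 1) {g : ℕ × ℕ × ℕ → ℝ} {M L : ℝ}
    (hM : ∀ᶠ n in atTop, ∀ k ≤ n, ∀ l ≤ n, |g (n, k, l)| ≤ M)
    (hg : Tendsto g (gridFilter x y) (𝓝 L)) :
    Tendsto (fun n : ℕ => ∑ k ∈ range (n + 1), ∑ l ∈ range (n + 1),
      g (n, k, l) * (bern n k x * bern n l y)) atTop (𝓝 L) := by
  have sum_weights (n : ℕ) (c : ℝ) :
      ∑ k ∈ range (n + 1), ∑ l ∈ range (n + 1), c * (bern n k x * bern n l y) = c := by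
    simp only [← Finset.mul_sum, sum_bern, mul_one]
  rw [Metric.tendsto_atTop']
  intro ε hε
  have hev : ∀ᶠ i in gridFilter x y, |g i - L| < ε / 2 := by
    simpa [Real.dist_eq] using Metric.tendsto_nhds.1 hg (ε / 2) (half_pos hε)
  rw [gridFilter, eventually_inf_principal, eventually_comap, eventually_prod_iff] at hev
  obtain ⟨pa, hpa, pb, hpb, hp⟩ := hev
  obtain ⟨δ, hδ, hball⟩ := Metric.eventually_nhds_iff.1 hpb
  set C := (|M| + |L|) / δ ^ 2 with hC
  have hC0 : 0 ≤ C := by positivity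
  have hlim : Tendsto (fun n : ℕ => C * (x * (1 - x) + y * (1 - y)) / n) atTop (𝓝 0) :=
    tendsto_const_div_atTop_nhds_zero_nat _
  have hsmall := hlim.eventually (gt_mem_nhds (half_pos hε))
  obtain ⟨N, hN⟩ := eventually_atTop.1
    (hM.and (hpa.and (hsmall.and (eventually_ge_atTop 1))))
  refine ⟨N, fun n hn => ?_⟩
  obtain ⟨hMn, hpn, hsn, hn1⟩ := hN n hn.le
  have hn0 : n ≠ 0 := by omega
  have pointwise : ∀ k ≤ n, ∀ l ≤ n,
      |g (n, k, l) - L| ≤ ε / 2 + C * (((k : ℝ) / n - x) ^ 2 + ((l : ℝ) / n - y) ^ 2) := by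
    intro k hk l hl
    by_cases hd : dist ((k : ℝ) / n, (l : ℝ) / n) (x, y) < δ
    · have := hp hpn (hball hd) (n, k, l) rfl ⟨hk, hl⟩
      have h2 : 0 ≤ C * (((k : ℝ) / n - x) ^ 2 + ((l : ℝ) / n - y) ^ 2) := by positivity
      linarith
    · have hsq : δ ^ 2 ≤ ((k : ℝ) / n - x) ^ 2 + ((l : ℝ) / n - y) ^ 2 := by
        rw [not_lt, Prod.dist_eq, le_max_iff, Real.dist_eq, Real.dist_eq] at hd
        rcases hd with hd | hd
        · have := pow_le_pow_left₀ hδ.le hd 2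
          rw [sq_abs] at this
          nlinarith [sq_nonneg ((l : ℝ) / n - y)]
        · have := pow_le_pow_left₀ hδ.le hd 2
          rw [sq_abs] at this
          nlinarith [sq_nonneg ((k : ℝ) / n - x)]
      calc |g (n, k, l) - L| ≤ |g (n, k, l)| + |L| := abs_sub _ _
        _ ≤ |M| + |L| := by
          have := (hMn k hk l hl).trans (le_abs_self M)
          linarith
        _ = C * δ ^ 2 := by rw [hC]; field_simp
        _ ≤ C * (((k : ℝ) / n - x) ^ 2 + ((l : ℝ) / n - y) ^ 2) := by gcongr
        _ ≤ _ := by linarith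
  rw [Real.dist_eq]
  conv_lhs => rw [← sum_weights n L]
  simp only [← Finset.sum_sub_distrib, ← sub_mul]
  have w0 (k l : ℕ) : 0 ≤ bern n k x * bern n l y :=
    mul_nonneg (bern_nonneg hx n k) (bern_nonneg hy n l)
  calc |∑ k ∈ range (n + 1), ∑ l ∈ range (n + 1),
        (g (n, k, l) - L) * (bern n k x * bern n l y)|
      ≤ ∑ k ∈ range (n + 1), ∑ l ∈ range (n + 1),
        (ε / 2 + C * (((k : ℝ) / n - x) ^ 2 + ((l : ℝ) / n - y) ^ 2)) *
          (bern n k x * bern n l y) := by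
        refine (Finset.abs_sum_le_sum_abs _ _).trans (Finset.sum_le_sum fun k hk => ?_)
        refine (Finset.abs_sum_le_sum_abs _ _).trans (Finset.sum_le_sum fun l hl => ?_)
        rw [abs_mul, abs_of_nonneg (w0 k l)]
        exact mul_le_mul_of_nonneg_right
          (pointwise k (Finset.mem_range_succ_iff.1 hk) l (Finset.mem_range_succ_iff.1 hl)) (w0 k l)
    _ = ε / 2 * ((∑ k ∈ range (n + 1), bern n k x) * ∑ l ∈ range (n + 1), bern n l y) +
        C * ((∑ k ∈ range (n + 1), ((k : ℝ) / n - x) ^ 2 * bern n k x) *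
          ∑ l ∈ range (n + 1), bern n l y) +
        C * ((∑ k ∈ range (n + 1), bern n k x) *
          ∑ l ∈ range (n + 1), ((l : ℝ) / n - y) ^ 2 * bern n l y) := by
        simp only [Finset.sum_mul_sum]
        simp only [Finset.mul_sum, ← Finset.sum_add_distrib]
        refine Finset.sum_congr rfl fun k _ => Finset.sum_congr rfl fun l _ => ?_
        ring
    _ = ε / 2 + C * (x * (1 - x) + y * (1 - y)) / n := by
        rw [sum_bern, sum_bern, sum_sq_mul_bern hn0, sum_sq_mul_bern hn0]
        ring
    _ < ε := by linarith

section Node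

variable {n k : ℕ}

theorem div_sub_akrNode_mul_add (hn : 2 ≤ n) :
    ((k : ℝ) / n - akrNode n k) * ((k : ℝ) / n + akrNode n k) =
      (k : ℝ) / n * (1 - (k : ℝ) / n) / (n - 1) := by
  have hn' : (2 : ℝ) ≤ n := by exact_mod_cast hn
  have hk : (0 : ℝ) ≤ k * (k - 1) := by
    rcases Nat.eq_zero_or_pos k with rfl | hk
    · simp
    · have : (1 : ℝ) ≤ k := by exact_mod_cast hk
      exact mul_nonneg (by linarith) (by linarith)
  have hsq : akrNode n k ^ 2 = (k * (k - 1)) / (n * (n - 1)) :=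
    Real.sq_sqrt (div_nonneg hk (mul_nonneg (by linarith) (by linarith)))
  have h0 : (n : ℝ) ≠ 0 := by linarith
  have h1 : (n : ℝ) - 1 ≠ 0 := by linarith
  rw [mul_comm, ← sq_sub_sq, hsq]
  field_simp
  ring

theorem akrNode_le_div (hn : 2 ≤ n) (hk : k ≤ n) : akrNode n k ≤ (k : ℝ) / n := by
  have hn' : (2 : ℝ) ≤ n := by exact_mod_cast hn
  have ha : (k : ℝ) / n ≤ 1 := div_le_one_of_le₀ (by exact_mod_cast hk) (by positivity)
  have h := div_sub_akrNode_mul_add (k := k) hn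
  have hr : 0 ≤ (k : ℝ) / n * (1 - (k : ℝ) / n) / (n - 1) :=
    div_nonneg (mul_nonneg (by positivity) (by linarith)) (by linarith)
  have : akrNode n k ^ 2 ≤ ((k : ℝ) / n) ^ 2 := by nlinarith
  exact (pow_le_pow_iff_left₀ (Real.sqrt_nonneg _) (by positivity) two_ne_zero).1 this

theorem abs_akrNode_sub_div_le (hn : 2 ≤ n) (hk : k ≤ n) :
    |akrNode n k - (k : ℝ) / n| ≤ 2 / n := by
  have hn' : (2 : ℝ) ≤ n := by exact_mod_cast hn
  have hle := akrNode_le_div hn hk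
  rw [abs_sub_comm, abs_of_nonneg (sub_nonneg.2 hle)]
  have h0 : 0 ≤ akrNode n k := Real.sqrt_nonneg _
  rcases (show (0 : ℝ) ≤ (k : ℝ) / n by positivity).eq_or_lt with ha | ha
  · have : (0 : ℝ) ≤ 2 / n := by positivity
    linarith
  have h := div_sub_akrNode_mul_add (k := k) hn
  have h1 : ((k : ℝ) / n - akrNode n k) * ((k : ℝ) / n) ≤ 2 / n * ((k : ℝ) / n) :=
    calc _ ≤ ((k : ℝ) / n - akrNode n k) * ((k : ℝ) / n + akrNode n k) := by
          gcongr
          linarith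
      _ = (k : ℝ) / n * (1 - (k : ℝ) / n) / (n - 1) := h
      _ ≤ (k : ℝ) / n * 1 / (n / 2) := by
          gcongr <;> linarith
      _ = _ := by field_simp
  exact le_of_mul_le_mul_right h1 ha

theorem akrNode_mem_Icc (hn : 2 ≤ n) (hk : k ≤ n) : akrNode n k ∈ Set.Icc (0 : ℝ) 1 :=
  ⟨Real.sqrt_nonneg _, (akrNode_le_div hn hk).trans
    (div_le_one_of_le₀ (by exact_mod_cast hk) (by positivity))⟩

theorem div_mem_Icc (hk : k ≤ n) : (k : ℝ) / n ∈ Set.Icc (0 : ℝ) 1 :=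
  ⟨by positivity, div_le_one_of_le₀ (by exact_mod_cast hk) (by positivity)⟩

end Node

section NodeLimits

variable {ι : Type*} {F : Filter ι} {n k : ι → ℕ} {x : ℝ}

theorem tendsto_akrNode (hn : Tendsto n F atTop) (hk : ∀ᶠ i in F, k i ≤ n i)
    (hx : Tendsto (fun i => (k i : ℝ) / n i) F (𝓝 x)) :
    Tendsto (fun i => akrNode (n i) (k i)) F (𝓝 x) := by
  have hdiff : Tendsto (fun i => akrNode (n i) (k i) - (k i : ℝ) / n i) F (𝓝 0) := by
    refine squeeze_zero_norm' ?_ ((tendsto_const_div_atTop_nhds_zero_nat 2).comp hn)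
    filter_upwards [hk, hn.eventually_ge_atTop 2] with i hki hni
    exact abs_akrNode_sub_div_le hni hki
  simpa using hdiff.add hx

theorem tendsto_mul_akrNode_sub_div (hn : Tendsto n F atTop) (hk : ∀ᶠ i in F, k i ≤ n i)
    (hx : Tendsto (fun i => (k i : ℝ) / n i) F (𝓝 x)) (hx0 : 0 < x) :
    Tendsto (fun i => (n i : ℝ) * (akrNode (n i) (k i) - (k i : ℝ) / n i)) F
      (𝓝 (-((1 - x) / 2))) := by
  have hratio : Tendsto (fun i => 1 + 1 / ((n i : ℝ) - 1)) F (𝓝 (1 + 0)) := by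
    refine tendsto_const_nhds.add (tendsto_const_nhds.div_atTop ?_)
    exact tendsto_atTop_add_const_right _ _ (tendsto_natCast_atTop_atTop.comp hn)
  have hlim := (hratio.mul ((hx.mul (tendsto_const_nhds.sub hx (a := 1))).div
    (hx.add (tendsto_akrNode hn hk hx)) (by positivity))).neg
  have hval : -((1 + 0) * (x * (1 - x) / (x + x))) = -((1 - x) / 2) := by
    field_simp
    ring
  rw [hval] at hlim
  refine hlim.congr' ?_
  filter_upwards [hn.eventually_ge_atTop 2, hx.eventually (lt_mem_nhds hx0)] with i hni hpos
  have hn' : (2 : ℝ) ≤ n i := by exact_mod_cast hni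
  have h1 : (n i : ℝ) - 1 ≠ 0 := by linarith
  have hsum : (k i : ℝ) / n i + akrNode (n i) (k i) ≠ 0 :=
    (add_pos_of_pos_of_nonneg hpos (Real.sqrt_nonneg _)).ne'
  have h := div_sub_akrNode_mul_add (k := k i) hni
  rw [← eq_div_iff hsum] at h
  rw [← neg_sub ((k i : ℝ) / n i), h]
  simp only [Pi.div_apply]
  generalize (k i : ℝ) / n i = a at *
  field_simp
  ring

end NodeLimits

/-- A function which is `C¹` on a convex set is strictly differentiable within that set. -/
theorem ContDiffOn.isLittleO_sub_sub_fderivWithin {E G ι : Type*} [NormedAddCommGroup E]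
    [NormedSpace ℝ E] [NormedAddCommGroup G] [NormedSpace ℝ G] {f : E → G} {s : Set E} {p : E}
    (hf : ContDiffOn ℝ 1 f s) (hs : Convex ℝ s) (hu : UniqueDiffOn ℝ s) (hp : p ∈ s)
    {F : Filter ι} {P Q : ι → E} (hP : Tendsto P F (𝓝[s] p)) (hQ : Tendsto Q F (𝓝[s] p)) :
    (fun i => f (P i) - f (Q i) - fderivWithin ℝ f s p (P i - Q i)) =o[F]
      fun i => P i - Q i := by
  rw [isLittleO_iff]
  intro c hc
  have hcont := (hf.continuousOn_fderivWithin hu le_rfl) p hp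
  have hev : ∀ᶠ z in 𝓝[s] p, ‖fderivWithin ℝ f s z - fderivWithin ℝ f s p‖ ≤ c := by
    filter_upwards [Metric.tendsto_nhds.1 hcont c hc] with z hz
    rw [← dist_eq_norm]
    exact hz.le
  obtain ⟨δ, hδ, hball⟩ := Metric.mem_nhdsWithin_iff.1 hev
  have hmem := inter_mem_nhdsWithin s (Metric.ball_mem_nhds p hδ)
  filter_upwards [hP hmem, hQ hmem] with i hPi hQi
  refine (hs.inter (convex_ball p δ)).norm_image_sub_le_of_norm_hasFDerivWithin_le'
    (f' := fun z => fderivWithin ℝ f s z) (fun z hz => ?_) (fun z hz => ?_) hQi hPi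
  · exact ((hf.differentiableOn one_ne_zero z hz.1).hasFDerivWithinAt).mono Set.inter_subset_left
  · exact hball ⟨hz.2, hz.1⟩

theorem convex_unitSquare : Convex ℝ unitSquare := (convex_Icc 0 1).prod (convex_Icc 0 1)

theorem uniqueDiffOn_unitSquare : UniqueDiffOn ℝ unitSquare :=
  (uniqueDiffOn_Icc zero_lt_one).prod (uniqueDiffOn_Icc zero_lt_one)

theorem isCompact_unitSquare : IsCompact unitSquare := isCompact_Icc.prod isCompact_Icc

theorem fderivWithin_unitSquare_apply {f : ℝ × ℝ → ℝ} {p : ℝ × ℝ} (hp : p ∈ unitSquare)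
    (hf : DifferentiableWithinAt ℝ f unitSquare p) (u v : ℝ) :
    fderivWithin ℝ f unitSquare p (u, v) = u * pderivX f p + v * pderivY f p := by
  have hX : HasDerivWithinAt (fun s => f (s, p.2)) (fderivWithin ℝ f unitSquare p (1, 0))
      (Set.Icc 0 1) p.1 :=
    hf.hasFDerivWithinAt.comp_hasDerivWithinAt (f := fun s => (s, p.2)) p.1
      ((hasDerivWithinAt_id _ _).prodMk (hasDerivWithinAt_const _ _ _)) fun s hs => ⟨hs, hp.2⟩
  have hY : HasDerivWithinAt (fun t => f (p.1, t)) (fderivWithin ℝ f unitSquare p (0, 1))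
      (Set.Icc 0 1) p.2 :=
    hf.hasFDerivWithinAt.comp_hasDerivWithinAt (f := fun t => (p.1, t)) p.2
      ((hasDerivWithinAt_const _ _ _).prodMk (hasDerivWithinAt_id _ _)) fun t ht => ⟨hp.1, ht⟩
  rw [pderivX, pderivY, hX.derivWithin (uniqueDiffOn_Icc zero_lt_one _ hp.1),
    hY.derivWithin (uniqueDiffOn_Icc zero_lt_one _ hp.2), ← smul_eq_mul, ← smul_eq_mul,
    ← map_smul, ← map_smul, ← map_add]
  simp

theorem stmt_11 (x y : ℝ) (hx : x ∈ Set.Ioc (0 : ℝ) 1) (hy : y ∈ Set.Ioc (0 : ℝ) 1)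
    (f : ℝ × ℝ → ℝ) (hf : ContDiffOn ℝ 2 f unitSquare) :
    Tendsto (fun n : ℕ => (n : ℝ) * (akr2Op n f x y - bernstein2Op n f x y)) atTop
      (nhds (-((1 - x) / 2) * pderivX f (x, y) - (1 - y) / 2 * pderivY f (x, y))) := by
  have hx' := Set.Ioc_subset_Icc_self hx
  have hy' := Set.Ioc_subset_Icc_self hy
  have hp : (x, y) ∈ unitSquare := ⟨hx', hy'⟩
  have hf1 : ContDiffOn ℝ 1 f unitSquare := hf.of_le one_le_two
  let P : ℕ × ℕ × ℕ → ℝ × ℝ := fun i => (akrNode i.1 i.2.1, akrNode i.1 i.2.2)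
  let Q : ℕ × ℕ × ℕ → ℝ × ℝ := fun i => ((i.2.1 : ℝ) / i.1, (i.2.2 : ℝ) / i.1)
  let g : ℕ × ℕ × ℕ → ℝ := fun i => i.1 * (f (P i) - f (Q i))
  have hbound : ∃ M, ∀ᶠ n in atTop, ∀ k ≤ n, ∀ l ≤ n, |g (n, k, l)| ≤ M := by
    obtain ⟨C, hC⟩ := hf1.exists_lipschitzOnWith one_ne_zero convex_unitSquare isCompact_unitSquare
    refine ⟨C * 2, ?_⟩
    filter_upwards [eventually_ge_atTop 2] with n hn k hk l hl
    have hlip := hC.dist_le_mul (P (n, k, l)) ⟨akrNode_mem_Icc hn hk, akrNode_mem_Icc hn hl⟩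
      (Q (n, k, l)) ⟨div_mem_Icc hk, div_mem_Icc hl⟩
    have hdist : dist (P (n, k, l)) (Q (n, k, l)) ≤ 2 / n :=
      max_le (abs_akrNode_sub_div_le hn hk) (abs_akrNode_sub_div_le hn hl)
    have hn0 : (n : ℝ) ≠ 0 := by positivity
    calc |g (n, k, l)| = n * dist (f (P (n, k, l))) (f (Q (n, k, l))) := by
          rw [Real.dist_eq, abs_mul, Nat.abs_cast]
      _ ≤ n * (C * (2 / n)) := by
          gcongr
          exact hlip.trans (by gcongr)
      _ = C * 2 := by field_simp
  obtain ⟨M, hM⟩ := hbound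
  have hgrid : Tendsto (fun i : ℕ × ℕ × ℕ => (i.1, Q i)) (gridFilter x y) (atTop ×ˢ 𝓝 (x, y)) :=
    tendsto_comap.mono_left inf_le_left
  have hn : Tendsto (fun i : ℕ × ℕ × ℕ => i.1) (gridFilter x y) atTop :=
    tendsto_fst.comp (f := fun i : ℕ × ℕ × ℕ => (i.1, Q i)) hgrid
  have hQ : Tendsto Q (gridFilter x y) (𝓝 (x, y)) :=
    tendsto_snd.comp (f := fun i : ℕ × ℕ × ℕ => (i.1, Q i)) hgrid
  have hle : ∀ᶠ i in gridFilter x y, i.2.1 ≤ i.1 ∧ i.2.2 ≤ i.1 :=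
    mem_inf_of_right (mem_principal_self _)
  have hk := hle.mono fun i hi => hi.1
  have hl := hle.mono fun i hi => hi.2
  have hQ1 := (continuous_fst.tendsto (x, y)).comp hQ
  have hQ2 := (continuous_snd.tendsto (x, y)).comp hQ
  have hP : Tendsto P (gridFilter x y) (𝓝 (x, y)) :=
    (tendsto_akrNode hn hk hQ1).prodMk_nhds (tendsto_akrNode hn hl hQ2)
  have hPs : Tendsto P (gridFilter x y) (𝓝[unitSquare] (x, y)) := by
    refine tendsto_nhdsWithin_iff.2 ⟨hP, ?_⟩
    filter_upwards [hle, hn.eventually_ge_atTop 2] with i hi hi2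
    exact ⟨akrNode_mem_Icc hi2 hi.1, akrNode_mem_Icc hi2 hi.2⟩
  have hQs : Tendsto Q (gridFilter x y) (𝓝[unitSquare] (x, y)) := by
    refine tendsto_nhdsWithin_iff.2 ⟨hQ, ?_⟩
    filter_upwards [hle] with i hi
    exact ⟨div_mem_Icc hi.1, div_mem_Icc hi.2⟩
  have hscaled : Tendsto (fun i => (i.1 : ℝ) • (P i - Q i)) (gridFilter x y)
      (𝓝 (-((1 - x) / 2), -((1 - y) / 2))) :=
    (tendsto_mul_akrNode_sub_div hn hk hQ1 hx.1).prodMk_nhds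
      (tendsto_mul_akrNode_sub_div hn hl hQ2 hy.1)
  have hrem := hf1.isLittleO_sub_sub_fderivWithin convex_unitSquare uniqueDiffOn_unitSquare hp
    hPs hQs
  have hrem0 := (isLittleO_one_iff ℝ).1
    (((isBigO_refl (fun i : ℕ × ℕ × ℕ => (i.1 : ℝ)) _).smul_isLittleO hrem).trans_isBigO
      (hscaled.isBigO_one ℝ))
  have hlim := hrem0.add
    (((fderivWithin ℝ f unitSquare (x, y)).continuous.tendsto _).comp hscaled)
  rw [fderivWithin_unitSquare_apply hp (hf1.differentiableOn one_ne_zero _ hp)] at hlim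
  have hg : Tendsto g (gridFilter x y)
      (𝓝 (-((1 - x) / 2) * pderivX f (x, y) - (1 - y) / 2 * pderivY f (x, y))) := by
    convert hlim using 1
    · ext i
      simp only [g, Function.comp_apply, map_smul, smul_eq_mul]
      ring
    · congr 1
      ring
  refine (tendsto_sum_bern_of_tendsto_gridFilter hx' hy' hM hg).congr fun n => ?_
  simp only [akr2Op, bernstein2Op, ← Finset.sum_sub_distrib, Finset.mul_sum]
  refine Finset.sum_congr rfl fun k _ => Finset.sum_congr rfl fun l _ => ?_
  simp only [g, P, Q]
  ring
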